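/- Assume G ∈ L¹(D × D) is symmetric and positive semidefinite as a kernel (∫_D∫_D G(x,y) u(x) u(y) dx dy ≥ 0 for every bounded measurable u). Let ω^λ = λ(1_{Ω₁} − 1_{Ω₂}) be the UNIQUE maximizer of E over K_λ, with Ω_i ⊆ B_i measurable, i = 1,2, and assume the nondegeneracy property: there exists δ₁ > 0 such that for every ω̃ ∈ F_{ω^λ} with ‖ω̃ − ω^λ‖_{L¹(D)} < δ₁, writing ψ̃(x) = ∫_D G(x,y) ω̃(y) dy, there exist ν₁ > 0 and ν₂ > 0 with |{ψ̃ > ν₁}| = |Ω₁|, |{ψ̃ < −ν₂}| = |Ω₂|, {ψ̃ > ν₁} ⊆ B₁ and {ψ̃ < −ν₂} ⊆ B₂. Then ω^λ is a STRICT local maximizer of E relative to F_{ω^λ}: there exists δ₀ > 0 such that every ω̃ ∈ F_{ω^λ} with 0 < ‖ω̃ − ω^λ‖_{L¹(D)} < δ₀ satisfies E(ω̃) < E(ω^λ). -/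

import Mathlib

open MeasureTheory Metric Set Filter Topology Real

noncomputable section

abbrev Pt : Type := EuclideanSpace ℝ (Fin 2)

def IsAdmissiblePair (D B1 B2 : Set Pt) (κ1 κ2 lam : ℝ) (ω1 ω2 : Pt → ℝ) : Prop :=
  Measurable ω1 ∧ Measurable ω2 ∧
  (∀ᵐ x ∂(volume.restrict D), 0 ≤ ω1 x ∧ ω1 x ≤ lam) ∧
  (∀ᵐ x ∂(volume.restrict D), -lam ≤ ω2 x ∧ ω2 x ≤ 0) ∧
  (∫ x in D, ω1 x) = κ1 ∧ (∫ x in D, ω2 x) = κ2 ∧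
  (∀ᵐ x ∂(volume.restrict D), x ∉ B1 → ω1 x = 0) ∧
  (∀ᵐ x ∂(volume.restrict D), x ∉ B2 → ω2 x = 0)

def InK (D B1 B2 : Set Pt) (κ1 κ2 lam : ℝ) (ω : Pt → ℝ) : Prop :=
  ∃ ω1 ω2 : Pt → ℝ, ω =ᵐ[volume.restrict D] ω1 + ω2 ∧
    IsAdmissiblePair D B1 B2 κ1 κ2 lam ω1 ω2

def energy (D : Set Pt) (G : Pt → Pt → ℝ) (ω : Pt → ℝ) : ℝ :=
  (1 / 2) * ∫ x in D, ∫ y in D, G x y * ω x * ω y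

/-- The rearrangement class of `ω` on `D`. -/
def rearrCl (D : Set Pt) (ω : Pt → ℝ) : Set (Pt → ℝ) :=
  {v | Measurable v ∧ ∀ a : ℝ, volume {x ∈ D | a < v x} = volume {x ∈ D | a < ω x}}

/-- The potential of `v` over the measure `μ` with kernel `G`. -/
def kernelPotential {α : Type*} [MeasurableSpace α] (μ : Measure α) (G : α → α → ℝ) (v : α → ℝ)
    (x : α) : ℝ :=
  ∫ y, G x y * v y ∂μ

section Kernel

variable {α : Type*} [MeasurableSpace α] {μ : Measure α} {G : α → α → ℝ}

theorem integrable_kernel_mul [SFinite μ]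
    (hG : Integrable (fun p : α × α => G p.1 p.2) (μ.prod μ))
    {u v : α → ℝ} (hu : Measurable u) (hv : Measurable v) {M N : ℝ}
    (hM : ∀ x, |u x| ≤ M) (hN : ∀ x, |v x| ≤ N) :
    Integrable (fun p : α × α => G p.1 p.2 * u p.1 * v p.2) (μ.prod μ) := by
  refine (hG.mul_bdd (c := M) (hu.comp measurable_fst).aestronglyMeasurable ?_).mul_bdd (c := N)
    (hv.comp measurable_snd).aestronglyMeasurable ?_
  · exact ae_of_all _ fun p => hM p.1
  · exact ae_of_all _ fun p => hN p.2

theorem integrable_kernelPotential [SFinite μ]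
    (hG : Integrable (fun p : α × α => G p.1 p.2) (μ.prod μ))
    {v : α → ℝ} (hv : Measurable v) {N : ℝ} (hN : ∀ x, |v x| ≤ N) :
    Integrable (kernelPotential μ G v) μ := by
  have h := (integrable_kernel_mul hG (u := fun _ => 1) (M := 1) measurable_const hv (by simp)
    hN).integral_prod_left
  simp only [mul_one] at h
  exact h

theorem integral_integral_kernel_mul (u v : α → ℝ) :
    ∫ x, ∫ y, G x y * u x * v y ∂μ ∂μ = ∫ x, u x * kernelPotential μ G v x ∂μ := by
  simp_rw [kernelPotential, ← integral_const_mul]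
  congr! 4
  ring

theorem integral_mul_kernelPotential_comm [SFinite μ]
    (hG : Integrable (fun p : α × α => G p.1 p.2) (μ.prod μ)) (hsym : ∀ x y, G x y = G y x)
    {u v : α → ℝ} (hu : Measurable u) (hv : Measurable v) {M N : ℝ}
    (hM : ∀ x, |u x| ≤ M) (hN : ∀ x, |v x| ≤ N) :
    ∫ x, u x * kernelPotential μ G v x ∂μ = ∫ x, v x * kernelPotential μ G u x ∂μ := by
  rw [← integral_integral_kernel_mul, ← integral_integral_kernel_mul,
    integral_integral_swap (integrable_kernel_mul hG hu hv hM hN)]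
  congr! 4 with x _ y
  rw [hsym]
  ring

theorem kernelPotential_sub_ae [SFinite μ]
    (hG : Integrable (fun p : α × α => G p.1 p.2) (μ.prod μ))
    {u v : α → ℝ} (hu : Measurable u) (hv : Measurable v) {M N : ℝ}
    (hM : ∀ x, |u x| ≤ M) (hN : ∀ x, |v x| ≤ N) :
    kernelPotential μ G (u - v) =ᵐ[μ] kernelPotential μ G u - kernelPotential μ G v := by
  have h1 := (integrable_kernel_mul hG (u := fun _ => 1) (M := 1) measurable_const hu (by simp)
    hM).prod_right_ae
  have h2 := (integrable_kernel_mul hG (u := fun _ => 1) (M := 1) measurable_const hv (by simp)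
    hN).prod_right_ae
  filter_upwards [h1, h2] with x hx1 hx2
  simp only [mul_one] at hx1 hx2
  simp only [kernelPotential, Pi.sub_apply, mul_sub]
  exact integral_sub hx1 hx2

/-- Convexity of the quadratic form of a symmetric positive semidefinite kernel. -/
theorem integral_mul_kernelPotential_ge [SFinite μ]
    (hG : Integrable (fun p : α × α => G p.1 p.2) (μ.prod μ)) (hsym : ∀ x y, G x y = G y x)
    (hpsd : ∀ u : α → ℝ, Measurable u → (∃ M, ∀ x, |u x| ≤ M) →
      0 ≤ ∫ x, ∫ y, G x y * u x * u y ∂μ ∂μ)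
    {u v : α → ℝ} (hu : Measurable u) (hv : Measurable v) {M N : ℝ}
    (hM : ∀ x, |u x| ≤ M) (hN : ∀ x, |v x| ≤ N) :
    2 * (∫ x, u x * kernelPotential μ G v x ∂μ) - ∫ x, v x * kernelPotential μ G v x ∂μ ≤
      ∫ x, u x * kernelPotential μ G u x ∂μ := by
  have hi : ∀ {f g : α → ℝ} {P Q : ℝ}, Measurable f → Measurable g → (∀ x, |f x| ≤ P) →
      (∀ x, |g x| ≤ Q) → Integrable (fun x => f x * kernelPotential μ G g x) μ :=
    fun hf hg hP hQ => (integrable_kernelPotential hG hg hQ).bdd_mul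
      hf.aestronglyMeasurable (ae_of_all _ hP)
  have h0 := hpsd (u - v) (hu.sub hv)
    ⟨M + N, fun x => (abs_sub _ _).trans (add_le_add (hM x) (hN x))⟩
  rw [integral_integral_kernel_mul] at h0
  have h1 : ∫ x, (u - v) x * kernelPotential μ G (u - v) x ∂μ =
      ∫ x, ((u x * kernelPotential μ G u x - u x * kernelPotential μ G v x) -
        (v x * kernelPotential μ G u x - v x * kernelPotential μ G v x)) ∂μ := by
    refine integral_congr_ae ?_
    filter_upwards [kernelPotential_sub_ae hG hu hv hM hN] with x hx
    rw [hx]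
    simp only [Pi.sub_apply]
    ring
  rw [h1, integral_sub ?_ ?_, integral_sub (hi hu hu hM hM) (hi hu hv hM hN),
    integral_sub (hi hv hu hN hM) (hi hv hv hN hN),
    integral_mul_kernelPotential_comm hG hsym hv hu hN hM] at h0
  · linarith
  · exact (hi hu hu hM hM).sub (hi hu hv hM hN)
  · exact (hi hv hu hN hM).sub (hi hv hv hN hN)

end Kernel

section Bathtub

variable {α : Type*} [MeasurableSpace α] {μ : Measure α}
  {f : α → ℝ} {c : ℝ} {T A : Set α}

theorem integral_indicator_diff_eq_setIntegral_sub [IsFiniteMeasure μ] (hf : Integrable f μ)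
    (hT : MeasurableSet T) (hA : MeasurableSet A) (hTA : μ T = μ A) :
    ∫ x, (f x - c) * (T.indicator 1 x - A.indicator 1 x) ∂μ =
      (∫ x in T, f x ∂μ) - ∫ x in A, f x ∂μ := by
  have hg : Integrable (fun x => f x - c) μ := hf.sub (integrable_const c)
  have h1 : (fun x => (f x - c) * (T.indicator 1 x - A.indicator 1 x)) =
      fun x => T.indicator (fun x => f x - c) x - A.indicator (fun x => f x - c) x := by
    funext x
    by_cases h : x ∈ T <;> by_cases h' : x ∈ A <;> simp [h, h']
  rw [h1, integral_sub (hg.indicator hT) (hg.indicator hA), integral_indicator hT,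
    integral_indicator hA, integral_sub hf.integrableOn (integrable_const c),
    integral_sub hf.integrableOn (integrable_const c)]
  simp [Measure.real, hTA]

theorem ae_nonneg_bathtub (h1 : ∀ᵐ x ∂μ, x ∈ T → c < f x) (h2 : ∀ᵐ x ∂μ, x ∉ T → f x ≤ c) :
    0 ≤ᵐ[μ] fun x => (f x - c) * (T.indicator 1 x - A.indicator 1 x) := by
  filter_upwards [h1, h2] with x h1 h2
  by_cases h : x ∈ T <;> by_cases h' : x ∈ A <;> simp [h, h'] <;> grind

/-- The bathtub principle: superlevel sets maximize the integral among sets of equal measure. -/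
theorem setIntegral_le_of_bathtub [IsFiniteMeasure μ] (hf : Integrable f μ) (hT : MeasurableSet T)
    (hA : MeasurableSet A) (hTA : μ T = μ A)
    (h1 : ∀ᵐ x ∂μ, x ∈ T → c < f x) (h2 : ∀ᵐ x ∂μ, x ∉ T → f x ≤ c) :
    ∫ x in A, f x ∂μ ≤ ∫ x in T, f x ∂μ := by
  rw [← sub_nonneg, ← integral_indicator_diff_eq_setIntegral_sub (c := c) hf hT hA hTA]
  exact integral_nonneg_of_ae (ae_nonneg_bathtub h1 h2)

theorem ae_eq_of_bathtub [IsFiniteMeasure μ] (hf : Integrable f μ) (hT : MeasurableSet T)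
    (hA : MeasurableSet A) (hTA : μ T = μ A)
    (h1 : ∀ᵐ x ∂μ, x ∈ T → c < f x) (h2 : ∀ᵐ x ∂μ, x ∉ T → f x ≤ c)
    (heq : ∫ x in T, f x ∂μ ≤ ∫ x in A, f x ∂μ) : T =ᵐ[μ] A := by
  have h0 := le_antisymm heq (setIntegral_le_of_bathtub hf hT hA hTA h1 h2)
  rw [← sub_eq_zero, ← integral_indicator_diff_eq_setIntegral_sub (c := c) hf hT hA hTA,
    integral_eq_zero_iff_of_nonneg_ae (ae_nonneg_bathtub h1 h2)] at h0
  · have hsub : T ≤ᵐ[μ] A := by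
      filter_upwards [h0, h1] with x hx hx1 hxT
      by_contra hxA
      have hxA' : x ∉ A := hxA
      have hxT' : x ∈ T := hxT
      simp [hxA', hxT'] at hx
      linarith [hx1 hxT']
    exact ae_eq_of_ae_subset_of_measure_ge hsub hTA.ge hT.nullMeasurableSet (measure_ne_top _ _)
  · refine (hf.sub (integrable_const c)).mul_bdd (c := 2) ?_ (ae_of_all _ fun x => ?_)
    · exact ((measurable_one.indicator hT).sub
        (measurable_one.indicator hA)).aestronglyMeasurable
    · by_cases h : x ∈ T <;> by_cases h' : x ∈ A <;> simp [h, h']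

end Bathtub

/-- The function equal to `c` on `A \ B` and to `-c` on `B \ A`, and vanishing elsewhere. -/
def twoPatch {α : Type*} (c : ℝ) (A B : Set α) (x : α) : ℝ :=
  c * (A.indicator 1 x - B.indicator 1 x)

section TwoPatch

variable {α : Type*} {c : ℝ} {A B : Set α}

theorem measurable_twoPatch [MeasurableSpace α] (hA : MeasurableSet A) (hB : MeasurableSet B) :
    Measurable (twoPatch c A B) :=
  ((measurable_one.indicator hA).sub (measurable_one.indicator hB)).const_mul c

theorem abs_twoPatch_le (hc : 0 ≤ c) (x : α) : |twoPatch c A B x| ≤ c := by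
  by_cases h : x ∈ A <;> by_cases h' : x ∈ B <;> simp [twoPatch, h, h', abs_of_nonneg hc, hc]

theorem integral_twoPatch_mul [MeasurableSpace α] {μ : Measure α} {f : α → ℝ} (hf : Integrable f μ)
    (hA : MeasurableSet A) (hB : MeasurableSet B) :
    ∫ x, twoPatch c A B x * f x ∂μ = c * ((∫ x in A, f x ∂μ) - ∫ x in B, f x ∂μ) := by
  rw [← integral_indicator hA, ← integral_indicator hB,
    ← integral_sub (hf.indicator hA) (hf.indicator hB), ← integral_const_mul]
  refine integral_congr_ae (ae_of_all _ fun x => ?_)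
  by_cases h : x ∈ A <;> by_cases h' : x ∈ B <;> simp [twoPatch, h, h']

theorem twoPatch_mem (x : α) : twoPatch c A B x ∈ ({c, 0, -c} : Set ℝ) := by
  by_cases h : x ∈ A <;> by_cases h' : x ∈ B <;> simp [twoPatch, h, h']

theorem twoPatch_eq_self_iff (hc : 0 < c) (hAB : Disjoint A B) (x : α) :
    twoPatch c A B x = c ↔ x ∈ A := by
  have : x ∈ A → x ∉ B := fun h => Set.disjoint_left.1 hAB h
  by_cases h : x ∈ A <;> by_cases h' : x ∈ B <;> simp [twoPatch, h, h'] <;> grind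

theorem twoPatch_eq_neg_iff (hc : 0 < c) (hAB : Disjoint A B) (x : α) :
    twoPatch c A B x = -c ↔ x ∈ B := by
  have : x ∈ A → x ∉ B := fun h => Set.disjoint_left.1 hAB h
  by_cases h : x ∈ A <;> by_cases h' : x ∈ B <;> simp [twoPatch, h, h'] <;> grind

end TwoPatch

theorem map_eq_of_mem_rearrCl {D : Set Pt} (hD : volume D ≠ ⊤) {v w : Pt → ℝ}
    (hw : Measurable w) (hv : v ∈ rearrCl D w) :
    (volume.restrict D).map v = (volume.restrict D).map w := by
  have : IsFiniteMeasure (volume.restrict D) := ⟨by simpa using hD.lt_top⟩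
  have := Measure.isFiniteMeasure_map (volume.restrict D) v
  have := Measure.isFiniteMeasure_map (volume.restrict D) w
  have huniv : (volume.restrict D).map v univ = (volume.restrict D).map w univ := by
    rw [Measure.map_apply hv.1 .univ, Measure.map_apply hw .univ, preimage_univ, preimage_univ]
  refine Measure.ext_of_Iic _ _ fun a => ?_
  have hIoi : (volume.restrict D).map v (Ioi a) = (volume.restrict D).map w (Ioi a) := by
    rw [Measure.map_apply hv.1 measurableSet_Ioi, Measure.map_apply hw measurableSet_Ioi,
      Measure.restrict_apply (hv.1 measurableSet_Ioi),
      Measure.restrict_apply (hw measurableSet_Ioi), inter_comm, inter_comm _ D]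
    exact hv.2 a
  rw [← compl_Ioi, measure_compl measurableSet_Ioi (measure_ne_top _ _),
    measure_compl measurableSet_Ioi (measure_ne_top _ _), huniv, hIoi]

theorem measure_preimage_eq_of_mem_rearrCl {D : Set Pt} (hD : volume D ≠ ⊤) {v w : Pt → ℝ}
    (hw : Measurable w) (hv : v ∈ rearrCl D w) {S : Set ℝ} (hS : MeasurableSet S) :
    volume.restrict D (v ⁻¹' S) = volume.restrict D (w ⁻¹' S) := by
  rw [← Measure.map_apply hv.1 hS, ← Measure.map_apply hw hS, map_eq_of_mem_rearrCl hD hw hv]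

/-- A rearrangement of a two-patch function is a two-patch function. -/
theorem ae_eq_twoPatch_of_mem_rearrCl {D : Set Pt} (hD : volume D ≠ ⊤) {c : ℝ} (hc : 0 < c)
    {A B : Set Pt} (hA : MeasurableSet A) (hB : MeasurableSet B) {v : Pt → ℝ}
    (hv : v ∈ rearrCl D (twoPatch c A B)) :
    v =ᵐ[volume.restrict D] twoPatch c (v ⁻¹' {c}) (v ⁻¹' {-c}) := by
  have hS : MeasurableSet ({c, 0, -c} : Set ℝ)ᶜ := (Set.toFinite _).measurableSet.compl
  have h := measure_preimage_eq_of_mem_rearrCl hD (measurable_twoPatch hA hB) hv hS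
  have h0 : (twoPatch c A B) ⁻¹' ({c, 0, -c} : Set ℝ)ᶜ = ∅ :=
    eq_empty_of_forall_notMem fun x hx => hx (twoPatch_mem x)
  rw [h0, measure_empty] at h
  have h' : ∀ᵐ x ∂volume.restrict D, v x ∈ ({c, 0, -c} : Set ℝ) := by
    rw [ae_iff]
    exact h
  filter_upwards [h'] with x hx
  have hcc : c ≠ -c := by linarith
  rcases hx with hx | hx | hx
  · simp [twoPatch, hx, hcc]
  · simp [twoPatch, hx, hc.ne, hc.ne']
  · have hx' : v x = -c := hx
    simp [twoPatch, hx', hcc.symm]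

theorem twoPatch_congr_ae {α : Type*} [MeasurableSpace α] {μ : Measure α} {c : ℝ}
    {A B A' B' : Set α} (hA : A =ᵐ[μ] A') (hB : B =ᵐ[μ] B') :
    twoPatch c A B =ᵐ[μ] twoPatch c A' B' := by
  filter_upwards [hA.mem_iff, hB.mem_iff] with x h h'
  by_cases hx : x ∈ A' <;> by_cases hx' : x ∈ B' <;> simp_all [twoPatch]

theorem energy_eq (D : Set Pt) (G : Pt → Pt → ℝ) (v : Pt → ℝ) :
    energy D G v = 1 / 2 * ∫ x in D, v x * kernelPotential (volume.restrict D) G v x := by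
  rw [energy, integral_integral_kernel_mul]

theorem kernelPotential_congr {α : Type*} [MeasurableSpace α] {μ : Measure α} {G : α → α → ℝ}
    {v w : α → ℝ} (h : v =ᵐ[μ] w) : kernelPotential μ G v = kernelPotential μ G w := by
  funext x
  refine integral_congr_ae ?_
  filter_upwards [h] with y hy
  rw [hy]

theorem energy_congr {D : Set Pt} {G : Pt → Pt → ℝ} {v w : Pt → ℝ}
    (h : v =ᵐ[volume.restrict D] w) : energy D G v = energy D G w := by
  rw [energy_eq, energy_eq, kernelPotential_congr h]
  congr 1
  refine integral_congr_ae ?_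
  filter_upwards [h] with y hy
  rw [hy]

/-- The masses of the two parts of a two-patch member of `K`. -/
theorem mass_of_inK_twoPatch {D B1 B2 A1 A2 : Set Pt} {κ1 κ2 lam c : ℝ}
    (hB : Disjoint B1 B2) (hA1 : MeasurableSet A1) (hA2 : MeasurableSet A2)
    (h1 : A1 ⊆ B1) (h2 : A2 ⊆ B2) (hK : InK D B1 B2 κ1 κ2 lam (twoPatch c A1 A2)) :
    c * (volume.restrict D).real A1 = κ1 ∧ -c * (volume.restrict D).real A2 = κ2 := by
  obtain ⟨ω1, ω2, hsum, -, -, -, -, hi1, hi2, hs1, hs2⟩ := hK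
  have key : ∀ᵐ x ∂volume.restrict D,
      ω1 x = A1.indicator (fun _ => c) x ∧ ω2 x = A2.indicator (fun _ => -c) x := by
    filter_upwards [hsum, hs1, hs2] with x hx hx1 hx2
    have : x ∈ B1 → x ∉ B2 := fun h => Set.disjoint_left.1 hB h
    have := @h1 x
    have := @h2 x
    by_cases h : x ∈ A1 <;> by_cases h' : x ∈ A2 <;> simp [twoPatch, h, h'] at hx ⊢ <;> grind
  rw [← hi1, ← hi2, integral_congr_ae (key.mono fun x hx => hx.1),
    integral_congr_ae (key.mono fun x hx => hx.2), integral_indicator_const _ hA1,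
    integral_indicator_const _ hA2]
  simp [mul_comm]

theorem inK_twoPatch {D B1 B2 A1 A2 : Set Pt} {κ1 κ2 c : ℝ} (hc : 0 ≤ c)
    (hA1 : MeasurableSet A1) (hA2 : MeasurableSet A2) (h1 : A1 ⊆ B1) (h2 : A2 ⊆ B2)
    (hκ1 : c * (volume.restrict D).real A1 = κ1)
    (hκ2 : -c * (volume.restrict D).real A2 = κ2) :
    InK D B1 B2 κ1 κ2 c (twoPatch c A1 A2) := by
  refine ⟨A1.indicator fun _ => c, A2.indicator fun _ => -c, ae_of_all _ fun x => ?_,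
    measurable_const.indicator hA1, measurable_const.indicator hA2, ae_of_all _ fun x => ?_,
    ae_of_all _ fun x => ?_, ?_, ?_, ae_of_all _ fun x hx => ?_, ae_of_all _ fun x hx => ?_⟩
  · by_cases h : x ∈ A1 <;> by_cases h' : x ∈ A2 <;> simp [twoPatch, h, h']
  · by_cases h : x ∈ A1 <;> simp [h, hc]
  · by_cases h : x ∈ A2 <;> simp [h, hc]
  · rw [integral_indicator_const _ hA1, ← hκ1, smul_eq_mul, mul_comm]
  · rw [integral_indicator_const _ hA2, ← hκ2, smul_eq_mul, mul_comm]
  · exact indicator_of_notMem (fun h => hx (h1 h)) _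
  · exact indicator_of_notMem (fun h => hx (h2 h)) _

theorem stmt17
    (D : Set Pt) (hDo : IsOpen D) (hDb : Bornology.IsBounded D)
    (xb1 xb2 : Pt) (hx : xb1 ≠ xb2) (δ : ℝ) (hδ : 0 < δ)
    (hB1D : closedBall xb1 δ ⊆ D) (hB2D : closedBall xb2 δ ⊆ D)
    (hBdisj : Disjoint (closedBall xb1 δ) (closedBall xb2 δ))
    (κ1 κ2 : ℝ) (hκ1 : 0 < κ1) (hκ2 : κ2 < 0)
    (G : Pt → Pt → ℝ)
    (hG : IntegrableOn (fun p : Pt × Pt => G p.1 p.2) (D ×ˢ D))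
    (hGsym : ∀ x y, G x y = G y x)
    (hGpsd : ∀ u : Pt → ℝ, Measurable u → (∃ M, ∀ x, |u x| ≤ M) →
      0 ≤ ∫ x in D, ∫ y in D, G x y * u x * u y)
    (lam : ℝ) (hlam : 0 < lam)
    (Ω1 Ω2 : Set Pt) (hΩ1 : MeasurableSet Ω1) (hΩ2 : MeasurableSet Ω2)
    (hΩ1B : Ω1 ⊆ closedBall xb1 δ) (hΩ2B : Ω2 ⊆ closedBall xb2 δ)
    (ωl : Pt → ℝ)
    (hform : ωl = fun x => lam * (Ω1.indicator 1 x - Ω2.indicator 1 x))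
    (hmem : InK D (closedBall xb1 δ) (closedBall xb2 δ) κ1 κ2 lam ωl)
    (hmax : ∀ ω, InK D (closedBall xb1 δ) (closedBall xb2 δ) κ1 κ2 lam ω →
      energy D G ω ≤ energy D G ωl)
    (huniq : ∀ ω, InK D (closedBall xb1 δ) (closedBall xb2 δ) κ1 κ2 lam ω →
      energy D G ω = energy D G ωl → ω =ᵐ[volume.restrict D] ωl)
    (δ1 : ℝ) (hδ1 : 0 < δ1)
    (hnd : ∀ ω' ∈ rearrCl D ωl, (∫ x in D, |ω' x - ωl x|) < δ1 →
      ∀ ψ' : Pt → ℝ, (∀ x, ψ' x = ∫ y in D, G x y * ω' y) →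
      ∃ ν1 > 0, ∃ ν2 > 0,
        volume {x ∈ D | ν1 < ψ' x} = volume Ω1 ∧
        volume {x ∈ D | ψ' x < -ν2} = volume Ω2 ∧
        {x ∈ D | ν1 < ψ' x} ⊆ closedBall xb1 δ ∧
        {x ∈ D | ψ' x < -ν2} ⊆ closedBall xb2 δ) :
    ∃ δ0 > 0, ∀ ω' ∈ rearrCl D ωl,
      0 < (∫ x in D, |ω' x - ωl x|) → (∫ x in D, |ω' x - ωl x|) < δ0 →
      energy D G ω' < energy D G ωl := by
  have hDm := hDo.measurableSet
  have hDfin : volume D ≠ ⊤ := hDb.measure_lt_top.ne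
  have hfin : IsFiniteMeasure (volume.restrict D) := ⟨by simpa using hDfin.lt_top⟩
  replace hform : ωl = twoPatch lam Ω1 Ω2 := hform
  subst hform
  have hΩ : Disjoint Ω1 Ω2 := hBdisj.mono hΩ1B hΩ2B
  have hG' : Integrable (fun p : Pt × Pt => G p.1 p.2)
      ((volume.restrict D).prod (volume.restrict D)) := by
    rwa [Measure.prod_restrict]
  refine ⟨δ1, hδ1, fun ω' hω' hpos hlt => ?_⟩
  by_contra! hge
  obtain ⟨ν1, -, ν2, -, hm1, hm2, hs1, hs2⟩ := hnd ω' hω' hlt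
    (kernelPotential (volume.restrict D) G ω') fun _ => rfl
  have hv := ae_eq_twoPatch_of_mem_rearrCl hDfin hlam hΩ1 hΩ2 hω'
  have hA1 : MeasurableSet (ω' ⁻¹' {lam}) := hω'.1 (measurableSet_singleton _)
  have hA2 : MeasurableSet (ω' ⁻¹' {-lam}) := hω'.1 (measurableSet_singleton _)
  have hmA1 : volume.restrict D (ω' ⁻¹' {lam}) = volume.restrict D Ω1 := by
    rw [measure_preimage_eq_of_mem_rearrCl hDfin (measurable_twoPatch hΩ1 hΩ2) hω'
      (measurableSet_singleton _)]
    congr 1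
    ext x
    exact twoPatch_eq_self_iff hlam hΩ x
  have hmA2 : volume.restrict D (ω' ⁻¹' {-lam}) = volume.restrict D Ω2 := by
    rw [measure_preimage_eq_of_mem_rearrCl hDfin (measurable_twoPatch hΩ1 hΩ2) hω'
      (measurableSet_singleton _)]
    congr 1
    ext x
    exact twoPatch_eq_neg_iff hlam hΩ x
  rw [kernelPotential_congr hv] at hm1 hm2 hs1 hs2
  rw [energy_congr hv] at hge
  set A1 := ω' ⁻¹' {lam}
  set A2 := ω' ⁻¹' {-lam}
  have hvm := measurable_twoPatch (c := lam) hA1 hA2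
  have hψ := integrable_kernelPotential hG' hvm (abs_twoPatch_le hlam.le)
  set ψ := kernelPotential (volume.restrict D) G (twoPatch lam A1 A2)
  have hP1 : NullMeasurableSet {x | ν1 < ψ x} (volume.restrict D) :=
    nullMeasurableSet_lt aemeasurable_const hψ.aemeasurable
  have hP2 : NullMeasurableSet {x | ψ x < -ν2} (volume.restrict D) :=
    nullMeasurableSet_lt hψ.aemeasurable aemeasurable_const
  obtain ⟨T1, hT1s, hT1, hT1e⟩ :=
    (hDm.nullMeasurableSet.inter hP1).exists_measurable_subset_ae_eq
  obtain ⟨T2, hT2s, hT2, hT2e⟩ :=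
    (hDm.nullMeasurableSet.inter hP2).exists_measurable_subset_ae_eq
  have hmT1 : volume.restrict D T1 = volume.restrict D Ω1 := by
    rw [measure_congr hT1e, Measure.restrict_eq_self _ inter_subset_left,
      Measure.restrict_eq_self _ (hΩ1B.trans hB1D)]
    exact hm1
  have hmT2 : volume.restrict D T2 = volume.restrict D Ω2 := by
    rw [measure_congr hT2e, Measure.restrict_eq_self _ inter_subset_left,
      Measure.restrict_eq_self _ (hΩ2B.trans hB2D)]
    exact hm2
  have hwm := measurable_twoPatch (c := lam) hT1 hT2
  obtain ⟨hmass1, hmass2⟩ := mass_of_inK_twoPatch hBdisj hΩ1 hΩ2 hΩ1B hΩ2B hmem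
  have hwK : InK D (closedBall xb1 δ) (closedBall xb2 δ) κ1 κ2 lam (twoPatch lam T1 T2) := by
    refine inK_twoPatch hlam.le hT1 hT2 (hT1s.trans hs1) (hT2s.trans hs2) ?_ ?_
    · rw [Measure.real, hmT1]
      exact hmass1
    · rw [Measure.real, hmT2]
      exact hmass2
  have hc1 : ∀ᵐ x ∂volume.restrict D, x ∉ T1 → ψ x ≤ ν1 := by
    filter_upwards [hT1e.mem_iff, ae_restrict_mem hDm] with x hx hxD hxT
    by_contra! h
    exact hxT (hx.2 ⟨hxD, h⟩)
  have hc2 : ∀ᵐ x ∂volume.restrict D, x ∉ T2 → -ψ x ≤ ν2 := by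
    filter_upwards [hT2e.mem_iff, ae_restrict_mem hDm] with x hx hxD hxT
    by_contra! h
    exact hxT (hx.2 ⟨hxD, lt_neg_of_lt_neg h⟩)
  have ho1 : ∀ᵐ x ∂volume.restrict D, x ∈ T1 → ν1 < ψ x := ae_of_all _ fun x hx => (hT1s hx).2
  have ho2 : ∀ᵐ x ∂volume.restrict D, x ∈ T2 → ν2 < -ψ x :=
    ae_of_all _ fun x hx => lt_neg_of_lt_neg (hT2s hx).2
  have hTA1 := hmT1.trans hmA1.symm
  have hTA2 := hmT2.trans hmA2.symm
  have hb1 := setIntegral_le_of_bathtub hψ hT1 hA1 hTA1 ho1 hc1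
  have hb2 := setIntegral_le_of_bathtub hψ.neg hT2 hA2 hTA2 ho2 hc2
  have hbe1 := ae_eq_of_bathtub hψ hT1 hA1 hTA1 ho1 hc1
  have hbe2 := ae_eq_of_bathtub hψ.neg hT2 hA2 hTA2 ho2 hc2
  simp only [Pi.neg_apply, integral_neg] at hb2 hbe2
  have hconv := integral_mul_kernelPotential_ge hG' hGsym hGpsd hwm hvm
    (abs_twoPatch_le hlam.le) (abs_twoPatch_le hlam.le)
  have hmaxw := hmax _ hwK
  have hEv := energy_eq D G (twoPatch lam A1 A2)
  have hEw := energy_eq D G (twoPatch lam T1 T2)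
  rw [integral_twoPatch_mul hψ hT1 hT2, integral_twoPatch_mul hψ hA1 hA2] at hconv
  rw [integral_twoPatch_mul hψ hA1 hA2] at hEv
  have hl1 := mul_le_mul_of_nonneg_left hb1 hlam.le
  have hl2 := mul_le_mul_of_nonneg_left hb2 hlam.le
  have he1 := hbe1 (le_of_mul_le_mul_left (by linarith) hlam)
  have he2 := hbe2 (le_of_mul_le_mul_left (by linarith) hlam)
  have hwl := huniq _ hwK (by linarith)
  have hfinal : ω' =ᵐ[volume.restrict D] twoPatch lam Ω1 Ω2 :=
    hv.trans ((twoPatch_congr_ae he1 he2).symm.trans hwl)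
  refine hpos.ne' (integral_eq_zero_of_ae ?_)
  filter_upwards [hfinal] with x hx
  simp [hx]
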